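/- Let R be a commutative ring and ℒ the class of all Lucas R-modules. Then every R-module M has an ℒ-cover, i.e., there exists an R-homomorphism f : C → M with C a Lucas module such that Hom_R(C', C) → Hom_R(C', M) is surjective for every Lucas module C', and every endomorphism h of C with f ∘ h = f is an isomorphism. -/

import Mathlib

open CategoryTheory

universe u

/-- An ideal is dense if its annihilator in `R` is zero. -/
def Ideal.IsDense {R : Type u} [CommRing R] (I : Ideal R) : Prop :=
  ∀ r : R, (∀ a ∈ I, a * r = 0) → r = 0

/-- An ideal is semi-regular if it contains a finitely generated dense subideal. -/
def Ideal.IsSemiRegular {R : Type u} [CommRing R] (I : Ideal R) : Prop :=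
  ∃ J : Ideal R, J ≤ I ∧ J.FG ∧ J.IsDense

/-- Membership in `𝒬`: finitely generated semi-regular ideals. -/
def Ideal.IsInQ {R : Type u} [CommRing R] (I : Ideal R) : Prop :=
  I.FG ∧ I.IsSemiRegular

/-- An `R`-module is `𝒬`-torsion if every element is annihilated by some `I ∈ 𝒬`. -/
def IsQTorsion (R : Type u) [CommRing R] (M : Type u) [AddCommGroup M] [Module R M] : Prop :=
  ∀ x : M, ∃ I : Ideal R, I.IsInQ ∧ ∀ a ∈ I, a • x = 0

/-- An `R`-module is `𝒬`-torsion-free if no nonzero element is annihilated by any `I ∈ 𝒬`. -/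
def IsQTorsionFree (R : Type u) [CommRing R] (M : Type u) [AddCommGroup M] [Module R M] : Prop :=
  ∀ x : M, (∃ I : Ideal R, I.IsInQ ∧ ∀ a ∈ I, a • x = 0) → x = 0

/-- `Ext¹_R(A, B) = 0`. -/
def Ext1Vanishes (R : Type u) [CommRing R] (A B : Type u) [AddCommGroup A] [Module R A]
    [AddCommGroup B] [Module R B] : Prop :=
  Subsingleton (((Ext R (ModuleCat.{u} R) 1).obj (Opposite.op (ModuleCat.of R A))).obj
    (ModuleCat.of R B))

/-- A Lucas module is a `𝒬`-torsion-free module `M` with `Ext¹_R(R/I, M) = 0` for all `I ∈ 𝒬`. -/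
def IsLucasModule (R : Type u) [CommRing R] (M : Type u) [AddCommGroup M] [Module R M] : Prop :=
  IsQTorsionFree R M ∧ ∀ I : Ideal R, I.IsInQ → Ext1Vanishes R (R ⧸ I) M

section ExtOne

variable {R : Type u} [CommRing R]

open Limits in
lemma ext1Vanishes_iff_of_projectiveResolution {A : ModuleCat.{u} R} (P : ProjectiveResolution A)
    (B : Type u) [AddCommGroup B] [Module R B] :
    Ext1Vanishes R A B ↔ ∀ f : P.complex.X 1 →ₗ[R] B, f ∘ₗ (P.complex.d 2 1).hom = 0 →
      ∃ g : P.complex.X 0 →ₗ[R] B, g ∘ₗ (P.complex.d 1 0).hom = f := by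
  have e := P.isoExt (R := R) 1 (ModuleCat.of R B)
  rw [Ext1Vanishes, ← ModuleCat.isZero_iff_subsingleton]
  refine e.isZero_iff.trans ?_
  rw [← HomologicalComplex.exactAt_iff_isZero_homology,
    HomologicalComplex.exactAt_iff' _ 0 1 2 (by simp) (by simp), ShortComplex.moduleCat_exact_iff]
  constructor
  · intro h f hf
    obtain ⟨g, hg⟩ := h (ModuleCat.ofHom f) (ModuleCat.hom_ext hf)
    exact ⟨ModuleCat.Hom.hom g, congrArg ModuleCat.Hom.hom hg⟩
  · intro h f hf
    obtain ⟨g, hg⟩ := h (ModuleCat.Hom.hom f) (congrArg ModuleCat.Hom.hom hf)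
    exact ⟨ModuleCat.ofHom g, ModuleCat.hom_ext hg⟩

lemma ext1Vanishes_quotient_iff (I : Ideal R) (B : Type u) [AddCommGroup B] [Module R B] :
    Ext1Vanishes R (R ⧸ I) B ↔ ∀ f : I →ₗ[R] B, ∃ y : B, ∀ r : I, f r = (r : R) • y := by
  let P := ProjectiveResolution.of (ModuleCat.of R (R ⧸ I))
  let d := (P.complex.d 1 0).hom
  let p : P.complex.X 0 →ₗ[R] R ⧸ I := (P.π.f 0).hom
  have hp : Function.Surjective p := (ModuleCat.epi_iff_surjective (P.π.f 0)).1 inferInstance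
  have hdp (q) : p (d q) = 0 :=
    LinearMap.congr_fun (congrArg ModuleCat.Hom.hom P.complex_d_comp_π_f_zero) q
  have hker (x) (hx : p x = 0) : ∃ q, d q = x :=
    (ShortComplex.moduleCat_exact_iff _).1 P.exact₀ x hx
  have hker' (x) (hx : d x = 0) : ∃ q, (P.complex.d 2 1).hom q = x :=
    (ShortComplex.moduleCat_exact_iff _).1 (P.exact_succ 0) x hx
  obtain ⟨p₀, hp₀⟩ := hp 1
  have hpr (r : R) : p (r • p₀) = Ideal.Quotient.mk I r := by
    rw [map_smul, hp₀, ← map_one (Ideal.Quotient.mk I), ← Ideal.Quotient.mk_eq_mk,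
      ← Submodule.Quotient.mk_smul]
    simp
  have hproj : Module.Projective R (P.complex.X 0) :=
    (IsProjective.iff_projective _).2 (P.projective 0)
  obtain ⟨ε, hε⟩ := Module.projective_lifting_property (Submodule.mkQ I) p
    (Submodule.mkQ_surjective I)
  have hε (x) : Ideal.Quotient.mk I (ε x) = p x := LinearMap.congr_fun hε x
  have hεd (q) : ε (d q) ∈ I := by
    rw [← Ideal.Quotient.eq_zero_iff_mem, hε, hdp]
  rw [ext1Vanishes_iff_of_projectiveResolution P]
  constructor
  · intro h f
    obtain ⟨g, hg⟩ := h (f ∘ₗ (ε ∘ₗ d).codRestrict I hεd) (by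
      ext q
      have : d ((P.complex.d 2 1).hom q) = 0 :=
        LinearMap.congr_fun (congrArg ModuleCat.Hom.hom (P.complex.d_comp_d 2 1 0)) q
      have h2 : (ε ∘ₗ d).codRestrict I hεd ((P.complex.d 2 1).hom q) = 0 := by
        ext; simp [this]
      simp [h2])
    have hc : ε p₀ - 1 ∈ I := by
      rw [← Ideal.Quotient.eq_zero_iff_mem, map_sub, hε, hp₀, map_one]
      exact sub_self _
    refine ⟨g p₀ - f ⟨_, hc⟩, fun r ↦ ?_⟩
    obtain ⟨q, hq⟩ := hker ((r : R) • p₀) (by rw [hpr, Ideal.Quotient.eq_zero_iff_mem]; exact r.2)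
    have h1 := LinearMap.congr_fun hg q
    have h2 : (ε ∘ₗ d).codRestrict I hεd q = r + (r : R) • ⟨ε p₀ - 1, hc⟩ := by
      ext
      simp [hq]
      ring
    rw [LinearMap.comp_apply, LinearMap.comp_apply, h2, map_add, map_smul] at h1
    change g (d q) = _ at h1
    rw [hq, map_smul] at h1
    rw [smul_sub, h1, add_sub_cancel_right]
  · intro h f hf
    let φ : LinearMap.range d →ₗ[R] B :=
      (LinearMap.ker d).liftQ f (fun x hx ↦ by
        obtain ⟨q, rfl⟩ := hker' x hx
        exact LinearMap.congr_fun hf q) ∘ₗ d.quotKerEquivRange.symm.toLinearMap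
    have hφ (q) : φ ⟨d q, q, rfl⟩ = f q := by
      have : d.quotKerEquivRange.symm ⟨d q, q, rfl⟩ = Submodule.Quotient.mk q := by
        rw [LinearEquiv.symm_apply_eq]; rfl
      simp [φ, this]
    have hrange (x) (hx : p x = 0) : x ∈ LinearMap.range d := hker x hx
    obtain ⟨y, hy⟩ := h (φ ∘ₗ ((LinearMap.toSpanSingleton R _ p₀).comp I.subtype).codRestrict _
      (fun r ↦ hrange _ (by
        simpa [hpr] using Ideal.Quotient.eq_zero_iff_mem.2 r.2)))
    have hsub (x) : ((LinearMap.id : P.complex.X 0 →ₗ[R] _) -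
        (LinearMap.toSpanSingleton R _ p₀) ∘ₗ ε) x ∈
        LinearMap.range d := hrange _ (by
      simp only [LinearMap.sub_apply, LinearMap.id_apply, LinearMap.comp_apply,
        LinearMap.toSpanSingleton_apply, map_sub, hpr, hε, sub_self])
    refine ⟨φ ∘ₗ (LinearMap.id - (LinearMap.toSpanSingleton R _ p₀) ∘ₗ ε).codRestrict _ hsub +
      (LinearMap.toSpanSingleton R _ y) ∘ₗ ε, ?_⟩
    ext q
    have h1 := hy ⟨ε (d q), hεd q⟩
    simp only [LinearMap.comp_apply] at h1
    change φ _ + ε (d q) • y = _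
    rw [← h1, ← map_add, ← hφ]
    congr 1
    exact Subtype.ext (sub_add_cancel _ _)

end ExtOne

section Elementwise

variable {R : Type u} [CommRing R]

/-- The finite generating sets of ideals in `𝒬`. -/
def IsQGenerating (s : Finset R) : Prop := (Ideal.span (s : Set R)).IsInQ

/-- Lucas modules in terms of linear equations: for each finite set `s` generating an ideal in `𝒬`,
the system `a • x = m a` (`a ∈ s`) has at most one solution, and it has one as soon as
`a • m b = b • m a` for all `a, b ∈ s`. -/
structure HasLucasSolutions (R : Type u) [CommRing R] (M : Type u) [AddCommGroup M]
    [Module R M] : Prop where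
  eq_zero {s : Finset R} (hs : IsQGenerating s) {x : M} (hx : ∀ a ∈ s, a • x = 0) : x = 0
  exists_smul_eq {s : Finset R} (hs : IsQGenerating s) {m : R → M}
    (hm : ∀ a ∈ s, ∀ b ∈ s, a • m b = b • m a) : ∃ x, ∀ a ∈ s, a • x = m a

variable {M : Type u} [AddCommGroup M] [Module R M]

lemma HasLucasSolutions.eq_of_smul_eq (h : HasLucasSolutions R M) {s : Finset R}
    (hs : IsQGenerating s) {x y : M} (hxy : ∀ a ∈ s, a • x = a • y) : x = y :=
  sub_eq_zero.1 <| h.eq_zero hs fun a ha ↦ by rw [smul_sub, hxy a ha, sub_self]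

lemma smul_eq_zero_of_mem_span {s : Set R} {x : M} (hx : ∀ a ∈ s, a • x = 0) {r : R}
    (hr : r ∈ Ideal.span s) : r • x = 0 := by
  have : Ideal.span s ≤ LinearMap.ker (LinearMap.toSpanSingleton R M x) :=
    Ideal.span_le.2 fun a ha ↦ by simpa using hx a ha
  simpa using this hr

lemma isQTorsionFree_iff : IsQTorsionFree R M ↔
    ∀ s : Finset R, IsQGenerating s → ∀ x : M, (∀ a ∈ s, a • x = 0) → x = 0 := by
  constructor
  · intro h s hs x hx
    exact h x ⟨_, hs, fun r hr ↦ smul_eq_zero_of_mem_span hx hr⟩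
  · rintro h x ⟨I, hI, hx⟩
    obtain ⟨s, rfl⟩ := hI.1
    exact h s hI x fun a ha ↦ hx a (Ideal.subset_span ha)

/-- A compatible family of values on the generators of an ideal in `𝒬` extends to
the ideal. -/
lemma exists_linearMap_of_compatible (h : IsQTorsionFree R M) {s : Finset R} (hs : IsQGenerating s)
    {m : R → M} (hm : ∀ a ∈ s, ∀ b ∈ s, a • m b = b • m a) :
    ∃ f : Ideal.span (s : Set R) →ₗ[R] M, ∀ a (ha : a ∈ s), f ⟨a, Ideal.subset_span ha⟩ = m a := by
  let π : (s →₀ R) →ₗ[R] Ideal.span (s : Set R) :=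
    Finsupp.linearCombination R fun a : s ↦ ⟨a.1, Ideal.subset_span a.2⟩
  let μ : (s →₀ R) →ₗ[R] M := Finsupp.linearCombination R fun a : s ↦ m a
  have hμ (b) (hb : b ∈ s) (c : s →₀ R) : b • μ c = (π c : R) • m b := by
    induction c using Finsupp.induction_linear with
    | zero => simp
    | add x y hx hy => simp [hx, hy, add_smul]
    | single a r =>
      simp only [μ, π, Finsupp.linearCombination_single, Submodule.coe_smul, smul_eq_mul, mul_smul,
        ← hm b hb a a.2]
      exact smul_comm _ _ _
  have hπ : Function.Surjective π := by
    rw [← LinearMap.range_eq_top, Finsupp.range_linearCombination, eq_top_iff]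
    have := Submodule.span_span_coe_preimage (R := R) (s := (s : Set R))
    convert this.ge
    ext ⟨x, hx⟩
    simp [Subtype.ext_iff]
  have hker : LinearMap.ker π ≤ LinearMap.ker μ := fun c hc ↦
    isQTorsionFree_iff.1 h s hs _ fun b hb ↦ by
      rw [hμ b hb, LinearMap.mem_ker.1 hc, Submodule.coe_zero, zero_smul]
  refine ⟨(LinearMap.ker π).liftQ μ hker ∘ₗ (π.quotKerEquivOfSurjective hπ).symm, fun a ha ↦ ?_⟩
  have : (π.quotKerEquivOfSurjective hπ).symm ⟨a, Ideal.subset_span ha⟩ =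
      Submodule.Quotient.mk (Finsupp.single ⟨a, ha⟩ 1) := by
    rw [LinearEquiv.symm_apply_eq]
    simp [π, LinearMap.quotKerEquivOfSurjective]
  simp [this, μ]

theorem isLucasModule_iff_hasLucasSolutions : IsLucasModule R M ↔ HasLucasSolutions R M := by
  constructor
  · rintro ⟨h, h'⟩
    refine ⟨fun hs _ hx ↦ isQTorsionFree_iff.1 h _ hs _ hx, fun {s} hs m hm ↦ ?_⟩
    obtain ⟨f, hf⟩ := exists_linearMap_of_compatible h hs hm
    obtain ⟨y, hy⟩ := (ext1Vanishes_quotient_iff _ M).1 (h' _ hs) f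
    exact ⟨y, fun a ha ↦ by rw [← hf a ha, hy]⟩
  · intro h
    refine ⟨isQTorsionFree_iff.2 fun s hs x hx ↦ h.eq_zero hs hx, fun I hI ↦ ?_⟩
    rw [ext1Vanishes_quotient_iff]
    intro f
    obtain ⟨s, rfl⟩ := id hI.1
    classical
    let m (r : R) : M := if hr : r ∈ Ideal.span (s : Set R) then f ⟨r, hr⟩ else 0
    have hm {a} (ha : a ∈ Ideal.span (s : Set R)) : m a = f ⟨a, ha⟩ := dif_pos ha
    have hm' (a b) (ha : a ∈ Ideal.span (s : Set R)) (hb : b ∈ Ideal.span (s : Set R)) :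
        a • m b = b • m a := by
      rw [hm ha, hm hb, ← map_smul, ← map_smul]
      congr 1
      ext
      exact mul_comm _ _
    obtain ⟨y, hy⟩ := h.exists_smul_eq hI (m := m)
      fun a ha b hb ↦ hm' a b (Ideal.subset_span ha) (Ideal.subset_span hb)
    refine ⟨y, fun r ↦ h.eq_of_smul_eq hI fun a ha ↦ ?_⟩
    rw [← hm r.2, hm' _ _ (Ideal.subset_span ha) r.2, ← hy a ha]
    exact smul_comm _ _ _

end Elementwise

section Closure

variable {R : Type u} [CommRing R] {N P : Type u} [AddCommGroup N] [Module R N] [AddCommGroup P]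
  [Module R P]

lemma HasLucasSolutions.of_retract (h : HasLucasSolutions R N) (i : P →ₗ[R] N) (r : N →ₗ[R] P)
    (hri : ∀ x, r (i x) = x) : HasLucasSolutions R P where
  eq_zero {s} hs x hx := by
    rw [← hri x, h.eq_zero hs (x := i x) fun a ha ↦ by rw [← map_smul, hx a ha, map_zero],
      map_zero]
  exists_smul_eq {s} hs m hm := by
    obtain ⟨x, hx⟩ := h.exists_smul_eq hs (m := fun a ↦ i (m a)) fun a ha b hb ↦ by
      rw [← map_smul, hm a ha b hb, map_smul]
    exact ⟨r x, fun a ha ↦ by rw [← map_smul, hx a ha, hri]⟩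

lemma LinearEquiv.hasLucasSolutions (e : N ≃ₗ[R] P) (h : HasLucasSolutions R N) :
    HasLucasSolutions R P :=
  h.of_retract e.symm.toLinearMap e.toLinearMap e.apply_symm_apply

lemma HasLucasSolutions.of_subsingleton [Subsingleton N] : HasLucasSolutions R N where
  eq_zero _ _ _ := Subsingleton.elim _ _
  exists_smul_eq _ _ _ := ⟨0, fun _ _ ↦ Subsingleton.elim _ _⟩

lemma hasLucasSolutions_quotient_iff {S : Submodule R N} : HasLucasSolutions R (N ⧸ S) ↔
    (∀ s : Finset R, IsQGenerating s → ∀ x : N, (∀ a ∈ s, a • x ∈ S) → x ∈ S) ∧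
    (∀ s : Finset R, IsQGenerating s → ∀ m : R → N,
      (∀ a ∈ s, ∀ b ∈ s, a • m b - b • m a ∈ S) → ∃ x, ∀ a ∈ s, a • x - m a ∈ S) := by
  constructor
  · intro h
    refine ⟨fun s hs x hx ↦ ?_, fun s hs m hm ↦ ?_⟩
    · rw [← Submodule.Quotient.mk_eq_zero]
      refine h.eq_zero hs fun a ha ↦ ?_
      rw [← Submodule.Quotient.mk_smul, Submodule.Quotient.mk_eq_zero]
      exact hx a ha
    · obtain ⟨x, hx⟩ := h.exists_smul_eq hs (m := fun a ↦ Submodule.Quotient.mk (m a))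
        fun a ha b hb ↦ by
          rw [← Submodule.Quotient.mk_smul, ← Submodule.Quotient.mk_smul, Submodule.Quotient.eq]
          exact hm a ha b hb
      obtain ⟨x, rfl⟩ := Submodule.Quotient.mk_surjective S x
      refine ⟨x, fun a ha ↦ ?_⟩
      rw [← Submodule.Quotient.eq, Submodule.Quotient.mk_smul]
      exact hx a ha
  · rintro ⟨h, h'⟩
    refine ⟨fun {s} hs x hx ↦ ?_, fun {s} hs m hm ↦ ?_⟩
    · obtain ⟨x, rfl⟩ := Submodule.Quotient.mk_surjective S x
      rw [Submodule.Quotient.mk_eq_zero]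
      refine h s hs x fun a ha ↦ ?_
      rw [← Submodule.Quotient.mk_eq_zero, Submodule.Quotient.mk_smul]
      exact hx a ha
    · choose m' hm' using fun a ↦ Submodule.Quotient.mk_surjective S (m a)
      obtain ⟨x, hx⟩ := h' s hs m' fun a ha b hb ↦ by
        rw [← Submodule.Quotient.eq, Submodule.Quotient.mk_smul, Submodule.Quotient.mk_smul,
          hm', hm']
        exact hm a ha b hb
      refine ⟨Submodule.Quotient.mk x, fun a ha ↦ ?_⟩
      rw [← hm', ← Submodule.Quotient.mk_smul, Submodule.Quotient.eq]
      exact hx a ha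

lemma HasLucasSolutions.of_extension {S : Submodule R N} (h : HasLucasSolutions R S)
    (h' : HasLucasSolutions R (N ⧸ S)) : HasLucasSolutions R N := by
  have hS := (hasLucasSolutions_quotient_iff.1 h')
  refine ⟨fun {s} hs x hx ↦ ?_, fun {s} hs m hm ↦ ?_⟩
  · have hxS : x ∈ S := hS.1 s hs x fun a ha ↦ by rw [hx a ha]; exact S.zero_mem
    exact congrArg Subtype.val (h.eq_zero hs (x := ⟨x, hxS⟩) fun a ha ↦ Subtype.ext (hx a ha))
  · obtain ⟨x, hx⟩ := hS.2 s hs m fun a ha b hb ↦ by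
      rw [hm a ha b hb, sub_self]; exact S.zero_mem
    classical
    let m' (a : R) : S := if ha : a ∈ s then ⟨_, hx a ha⟩ else 0
    have hm' (a) (ha : a ∈ s) : (m' a : N) = a • x - m a := by simp [m', ha]
    obtain ⟨y, hy⟩ := h.exists_smul_eq hs (m := m') fun a ha b hb ↦ Subtype.ext <| by
      rw [Submodule.coe_smul, Submodule.coe_smul, hm' a ha, hm' b hb, smul_sub, smul_sub,
        hm a ha b hb, smul_comm]
    refine ⟨x - y, fun a ha ↦ ?_⟩
    have := congrArg Subtype.val (hy a ha)
    rw [Submodule.coe_smul, hm' a ha] at this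
    rw [smul_sub, this, sub_sub_cancel]

lemma HasLucasSolutions.quotient_of_le {S T : Submodule R N} (hST : S ≤ T)
    (h : HasLucasSolutions R ((N ⧸ S) ⧸ T.map S.mkQ)) : HasLucasSolutions R (N ⧸ T) :=
  (Submodule.quotientQuotientEquivQuotient S T hST).hasLucasSolutions h

lemma hasLucasSolutions_quotient_sSup {c : Set (Submodule R N)} (hc : c.Nonempty)
    (hdir : DirectedOn (· ≤ ·) c) (h : ∀ S ∈ c, HasLucasSolutions R (N ⧸ S)) :
    HasLucasSolutions R (N ⧸ sSup c) := by
  have key (t : Set N) (ht : t.Finite) (hts : t ⊆ (sSup c : Submodule R N)) :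
      ∃ S ∈ c, t ⊆ S := by
    have := (CompleteLattice.isCompactElement_iff_le_of_directed_sSup_le _ _).1
      ((Submodule.fg_iff_compact _).1 ⟨ht.toFinset, rfl⟩) c hc hdir (Submodule.span_le.2
        (by simpa using hts))
    obtain ⟨S, hS, hS'⟩ := this
    exact ⟨S, hS, by simpa [Submodule.span_le] using hS'⟩
  refine hasLucasSolutions_quotient_iff.2 ⟨fun s hs x hx ↦ ?_, fun s hs m hm ↦ ?_⟩
  · obtain ⟨S, hS, hS'⟩ := key ((· • x) '' (s : Set R)) (s.finite_toSet.image _) (by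
      rintro _ ⟨a, ha, rfl⟩
      exact hx a ha)
    exact le_sSup hS ((hasLucasSolutions_quotient_iff.1 (h S hS)).1 s hs x
      fun a ha ↦ hS' ⟨a, ha, rfl⟩)
  · obtain ⟨S, hS, hS'⟩ := key
      ((fun p : R × R ↦ p.1 • m p.2 - p.2 • m p.1) '' ((s : Set R) ×ˢ (s : Set R)))
      ((s.finite_toSet.prod s.finite_toSet).image _) (by
      rintro _ ⟨⟨a, b⟩, ⟨ha, hb⟩, rfl⟩
      exact hm a ha b hb)
    obtain ⟨x, hx⟩ := (hasLucasSolutions_quotient_iff.1 (h S hS)).2 s hs m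
      fun a ha b hb ↦ hS' ⟨(a, b), ⟨ha, hb⟩, rfl⟩
    exact ⟨x, fun a ha ↦ le_sSup hS (hx a ha)⟩

lemma hasLucasSolutions_quotient_range_mapRange {ι : Type*} {A B : ι → Type u}
    [∀ i, AddCommGroup (A i)] [∀ i, Module R (A i)] [∀ i, AddCommGroup (B i)]
    [∀ i, Module R (B i)] (f : ∀ i, A i →ₗ[R] B i)
    (h : ∀ i, HasLucasSolutions R (B i ⧸ LinearMap.range (f i))) :
    (∀ s : Finset R, IsQGenerating s → ∀ x : Π₀ i, B i,
      (∀ a ∈ s, a • x ∈ LinearMap.range (DFinsupp.mapRange.linearMap f)) →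
      x ∈ LinearMap.range (DFinsupp.mapRange.linearMap f)) ∧
    (∀ s : Finset R, IsQGenerating s → ∀ m : R → Π₀ i, B i, (∀ a ∈ s, ∀ b ∈ s, a • m b - b • m a ∈
      LinearMap.range (DFinsupp.mapRange.linearMap f)) →
      ∃ x, ∀ a ∈ s, a • x - m a ∈ LinearMap.range (DFinsupp.mapRange.linearMap f)) := by
  classical
  have key (x : Π₀ i, B i) : x ∈ LinearMap.range (DFinsupp.mapRange.linearMap f) ↔
      ∀ i, x i ∈ LinearMap.range (f i) := by
    constructor
    · rintro ⟨y, rfl⟩ i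
      exact ⟨y i, by simp⟩
    · intro hx
      choose y hy using hx
      refine ⟨DFinsupp.mk x.support fun i ↦ y i, DFinsupp.ext fun i ↦ ?_⟩
      by_cases hi : x i = 0
      · simp [hi]
      · simp [hi, hy]
  simp only [key]
  refine ⟨fun s hs x hx i ↦ ?_, fun s hs m hm ↦ ?_⟩
  · exact (hasLucasSolutions_quotient_iff.1 (h i)).1 s hs (x i) fun a ha ↦ hx a ha i
  · choose x hx using fun i ↦ (hasLucasSolutions_quotient_iff.1 (h i)).2 s hs (fun a ↦ m a i)
      fun a ha b hb ↦ hm a ha b hb i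
    refine ⟨DFinsupp.mk (s.biUnion fun a ↦ (m a).support) fun i ↦ x i, fun a ha i ↦ ?_⟩
    by_cases hi : i ∈ s.biUnion fun a ↦ (m a).support
    · simpa [DFinsupp.mk_apply, hi] using hx i a ha
    · have : m a i = 0 := by
        by_contra h0
        exact hi (Finset.mem_biUnion.2 ⟨a, ha, by simpa using h0⟩)
      simp only [DFinsupp.coe_sub, DFinsupp.coe_smul, Pi.sub_apply, Pi.smul_apply,
        DFinsupp.mk_apply, hi, dite_false, smul_zero, this, sub_zero]
      exact Submodule.zero_mem _

section Colimit

open Limits Filter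

variable {K : Type u} [LinearOrder K] [Nonempty K] {F : K ⥤ ModuleCat.{u} R} {c : Cocone F}

lemma ModuleCat.eventually_map_eq_of_isColimit (hc : IsColimit c) {k : K} {x y : F.obj k}
    (hxy : c.ι.app k x = c.ι.app k y) :
    ∀ᶠ k' in atTop, ∀ hk : k ≤ k', F.map (homOfLE hk) x = F.map (homOfLE hk) y := by
  obtain ⟨k₁, φ, ψ, h⟩ := Concrete.isColimit_exists_of_rep_eq F hc _ _ hxy
  filter_upwards [eventually_ge_atTop k₁] with k' hk' hk
  have e : F.map (homOfLE hk) = F.map φ ≫ F.map (homOfLE hk') := by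
    rw [← F.map_comp]; rfl
  rw [e, ModuleCat.comp_apply, ModuleCat.comp_apply, h,
    Subsingleton.elim φ ψ]

lemma ModuleCat.exists_rep_finset_of_isColimit (hc : IsColimit c) (t : Finset R) (m : R → c.pt) :
    ∃ (k : K) (n : R → F.obj k), ∀ a ∈ t, c.ι.app k (n a) = m a := by
  choose k y hy using fun a ↦ Concrete.isColimit_exists_rep F hc (m a)
  have : ∀ᶠ k' in atTop, ∀ a ∈ t, k a ≤ k' :=
    (eventually_all_finset t).2 fun a _ ↦ eventually_ge_atTop (k a)
  obtain ⟨k', hk'⟩ := this.exists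
  refine ⟨k', fun a ↦ if h : k a ≤ k' then F.map (homOfLE h) (y a) else 0, fun a ha ↦ ?_⟩
  dsimp only
  rw [dif_pos (hk' a ha), ← ModuleCat.comp_apply, c.w]
  exact hy a

/-- Lucas modules are closed under directed colimits because ideals in `𝒬` are finitely
generated. -/
lemma hasLucasSolutions_of_isColimit (hc : IsColimit c)
    (h : ∀ k, HasLucasSolutions R (F.obj k)) : HasLucasSolutions R c.pt := by
  refine ⟨fun {s} hs x hx ↦ ?_, fun {s} hs m hm ↦ ?_⟩
  · obtain ⟨k, x, rfl⟩ := Concrete.isColimit_exists_rep F hc x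
    have : ∀ᶠ k' in atTop, ∀ a ∈ s, ∀ hk : k ≤ k',
        F.map (homOfLE hk) (a • x) = F.map (homOfLE hk) 0 :=
      (eventually_all_finset s).2 fun a ha ↦ ModuleCat.eventually_map_eq_of_isColimit hc (by
        rw [map_smul, map_zero]; exact hx a ha)
    obtain ⟨k', hk', hk⟩ := (this.and (eventually_ge_atTop k)).exists
    have h0 := (h k').eq_zero hs (x := F.map (homOfLE hk) x) fun a ha ↦ by
      rw [← map_smul, hk' a ha hk, map_zero]
    rw [← c.w (homOfLE hk), ModuleCat.comp_apply, h0, map_zero]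
  · obtain ⟨k, n, hn⟩ := ModuleCat.exists_rep_finset_of_isColimit hc s m
    have : ∀ᶠ k' in atTop, ∀ a ∈ s, ∀ b ∈ s, ∀ hk : k ≤ k',
        F.map (homOfLE hk) (a • n b) = F.map (homOfLE hk) (b • n a) :=
      (eventually_all_finset s).2 fun a ha ↦ (eventually_all_finset s).2 fun b hb ↦
        ModuleCat.eventually_map_eq_of_isColimit hc (by
          rw [map_smul, map_smul, hn a ha, hn b hb]; exact hm a ha b hb)
    obtain ⟨k', hk', hk⟩ := (this.and (eventually_ge_atTop k)).exists
    obtain ⟨x, hx⟩ := (h k').exists_smul_eq hs (m := fun a ↦ F.map (homOfLE hk) (n a))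
      fun a ha b hb ↦ by rw [← map_smul, ← map_smul, hk' a ha b hb hk]
    refine ⟨c.ι.app k' x, fun a ha ↦ ?_⟩
    rw [← map_smul, hx a ha, ← ModuleCat.comp_apply, c.w, hn a ha]

end Colimit

end Closure

section Small

/-- Formal terms for the elements of the submodule generated by one element and closed under
solving linear systems. -/
inductive LucasTerm (R : Type u) : Type u
  | base : LucasTerm R
  | zero : LucasTerm R
  | add : LucasTerm R → LucasTerm R → LucasTerm R
  | smul : R → LucasTerm R → LucasTerm R
  | solve : Finset R → (R → LucasTerm R) → LucasTerm R
  | syzygy : Finset R → (R → R → LucasTerm R) → R → LucasTerm R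

variable {R : Type u} [CommRing R] {N : Type u} [AddCommGroup N] [Module R N]

open Classical in
/-- The value of a term at a base point `x`: `solve s m` is a solution `y` of `a • y = m a` for
`a ∈ s`, and `syzygy s c` a solution `m` of `a • m b - b • m a = c a b` for `a, b ∈ s`. -/
noncomputable def LucasTerm.eval (x : N) : LucasTerm R → N
  | base => x
  | zero => 0
  | add t t' => t.eval x + t'.eval x
  | smul r t => r • t.eval x
  | solve s m => Classical.epsilon fun y : N ↦ ∀ a ∈ s, a • y = (m a).eval x
  | syzygy s c a => (Classical.epsilon fun m : R → N ↦
      ∀ a ∈ s, ∀ b ∈ s, a • m b - b • m a = (c a b).eval x) a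

variable (R) in
/-- The submodule of values of terms at `x`. -/
noncomputable def LucasTerm.valueSubmodule (x : N) : Submodule R N where
  carrier := Set.range (eval (R := R) x)
  add_mem' := by
    rintro _ _ ⟨t, rfl⟩ ⟨t', rfl⟩
    exact ⟨add t t', by rw [eval]⟩
  zero_mem' := ⟨zero, by rw [eval]⟩
  smul_mem' := by
    rintro r _ ⟨t, rfl⟩
    exact ⟨smul r t, by rw [eval]⟩

lemma LucasTerm.self_mem_valueSubmodule (x : N) : x ∈ valueSubmodule R x := ⟨base, by rw [eval]⟩

lemma HasLucasSolutions.quotient_valueSubmodule (h : HasLucasSolutions R N) (x : N) :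
    HasLucasSolutions R (N ⧸ LucasTerm.valueSubmodule R x) := by
  refine hasLucasSolutions_quotient_iff.2 ⟨fun s hs y hy ↦ ?_, fun s hs m hm ↦ ?_⟩
  · have : ∀ a, ∃ t : LucasTerm R, a ∈ s → t.eval x = a • y := fun a ↦ by
      by_cases ha : a ∈ s
      · exact (hy a ha).imp fun t ht _ ↦ ht
      · exact ⟨.zero, fun ha' ↦ (ha ha').elim⟩
    choose t ht using this
    refine ⟨.solve s t, ?_⟩
    rw [LucasTerm.eval]
    refine h.eq_of_smul_eq hs fun a ha ↦ ?_
    rw [← ht a ha]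
    exact Classical.epsilon_spec (p := fun y : N ↦ ∀ a ∈ s, a • y = (t a).eval x)
      ⟨y, fun a ha ↦ (ht a ha).symm⟩ a ha
  · have : ∀ a b, ∃ t : LucasTerm R, a ∈ s → b ∈ s → t.eval x = a • m b - b • m a := fun a b ↦ by
      by_cases hab : a ∈ s ∧ b ∈ s
      · exact (hm a hab.1 b hab.2).imp fun t ht _ _ ↦ ht
      · exact ⟨.zero, fun ha hb ↦ (hab ⟨ha, hb⟩).elim⟩
    choose t ht using this
    have hm' (a) (ha : a ∈ s) (b) (hb : b ∈ s) :
        a • (LucasTerm.syzygy s t b).eval x - b • (LucasTerm.syzygy s t a).eval x =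
          a • m b - b • m a := by
      rw [← ht a b ha hb, LucasTerm.eval, LucasTerm.eval]
      exact Classical.epsilon_spec (p := fun m : R → N ↦
        ∀ a ∈ s, ∀ b ∈ s, a • m b - b • m a = (t a b).eval x)
        ⟨m, fun a ha b hb ↦ (ht a b ha hb).symm⟩ a ha b hb
    obtain ⟨y, hy⟩ := h.exists_smul_eq hs (m := fun a ↦ m a - (LucasTerm.syzygy s t a).eval x)
      fun a ha b hb ↦ by
        rw [smul_sub, smul_sub, sub_eq_sub_iff_sub_eq_sub, hm' a ha b hb]
    refine ⟨y, fun a ha ↦ ?_⟩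
    rw [hy a ha, sub_sub_cancel_left]
    exact Submodule.neg_mem _ ⟨_, rfl⟩

lemma HasLucasSolutions.of_submodule (h : HasLucasSolutions R N) {S : Submodule R N}
    (hS : HasLucasSolutions R (N ⧸ S)) : HasLucasSolutions R S where
  eq_zero hs x hx := Subtype.ext <| h.eq_zero hs fun a ha ↦ congrArg Subtype.val (hx a ha)
  exists_smul_eq {s} hs m hm := by
    obtain ⟨x, hx⟩ := h.exists_smul_eq hs (m := fun a ↦ (m a : N))
      fun a ha b hb ↦ congrArg Subtype.val (hm a ha b hb)
    exact ⟨⟨x, (hasLucasSolutions_quotient_iff.1 hS).1 s hs x fun a ha ↦ by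
      rw [hx a ha]; exact (m a).2⟩, fun a ha ↦ Subtype.ext (hx a ha)⟩

/-- Every element of a Lucas module lies in the image of a free module of rank depending on `R`
only such that kernel and cokernel behave well. -/
lemma HasLucasSolutions.exists_linearMap (h : HasLucasSolutions R N) (x : N) :
    ∃ π : (LucasTerm R →₀ R) →ₗ[R] N, x ∈ LinearMap.range π ∧
      HasLucasSolutions R (N ⧸ LinearMap.range π) ∧
      HasLucasSolutions R ((LucasTerm R →₀ R) ⧸ LinearMap.ker π) := by
  let π : (LucasTerm R →₀ R) →ₗ[R] N := Finsupp.linearCombination R (LucasTerm.eval x)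
  have hπ : LinearMap.range π = LucasTerm.valueSubmodule R x := by
    rw [Finsupp.range_linearCombination]
    exact (Submodule.span_eq (LucasTerm.valueSubmodule R x))
  refine ⟨π, hπ ▸ LucasTerm.self_mem_valueSubmodule x, hπ ▸ h.quotient_valueSubmodule x, ?_⟩
  exact π.quotKerEquivRange.symm.hasLucasSolutions
    (hπ ▸ h.of_submodule (h.quotient_valueSubmodule x))

end Small

section Generators

open Limits MorphismProperty

variable (R : Type u) [CommRing R]

/-- Monomorphisms with Lucas cokernel. -/
def lucasMonomorphisms : MorphismProperty (ModuleCat.{u} R) :=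
  fun _ _ f ↦ Mono f ∧ HasLucasSolutions R (cokernel f : ModuleCat.{u} R)

variable {R}

lemma CategoryTheory.Iso.hasLucasSolutions {A B : ModuleCat.{u} R} (e : A ≅ B)
    (h : HasLucasSolutions R A) : HasLucasSolutions R B :=
  e.toLinearEquiv.hasLucasSolutions h

lemma hasLucasSolutions_cokernel_iff {A B : ModuleCat.{u} R} (f : A ⟶ B) :
    HasLucasSolutions R (cokernel f : ModuleCat.{u} R) ↔
      HasLucasSolutions R (B ⧸ LinearMap.range f.hom) :=
  ⟨(ModuleCat.cokernelIsoRangeQuotient f).hasLucasSolutions,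
    (ModuleCat.cokernelIsoRangeQuotient f).symm.hasLucasSolutions⟩

instance : (lucasMonomorphisms R).IsStableUnderCobaseChange where
  of_isPushout {A A' B B' f g f' g'} sq hf := by
    have := hf.1
    have := isIso_cokernel_map_of_isPushout sq.flip
    exact ⟨(monomorphisms _).of_isPushout sq hf.1,
      (asIso (cokernel.map _ _ _ _ sq.flip.w)).hasLucasSolutions hf.2⟩

lemma lucasMonomorphisms_ofHom_mapRange {ι : Type u} {A B : ι → ModuleCat.{u} R}
    (f : ∀ i, A i ⟶ B i) (h : ∀ i, lucasMonomorphisms R (f i)) :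
    lucasMonomorphisms R (ModuleCat.ofHom (Y := Π₀ i, B i)
      (DFinsupp.mapRange.linearMap fun i ↦ (f i).hom)) := by
  constructor
  · rw [ModuleCat.mono_iff_injective]
    exact (DFinsupp.mapRange_injective (fun i ↦ (f i).hom) fun i ↦ map_zero _).2
      fun i ↦ (ModuleCat.mono_iff_injective _).1 (h i).1
  · rw [hasLucasSolutions_cokernel_iff, hasLucasSolutions_quotient_iff]
    exact hasLucasSolutions_quotient_range_mapRange _
      fun i ↦ (hasLucasSolutions_cokernel_iff (f i)).1 (h i).2

instance : IsStableUnderCoproducts.{u} (lucasMonomorphisms R) where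
  isStableUnderCoproductsOfShape ι := IsStableUnderCoproductsOfShape.mk _ _ fun A B _ _ f h ↦ by
    classical
    refine ((lucasMonomorphisms R).arrow_mk_iso_iff (Arrow.isoMk (ModuleCat.coprodIsoDirectSum A)
      (ModuleCat.coprodIsoDirectSum B) ?_)).2 (lucasMonomorphisms_ofHom_mapRange f h)
    change (ModuleCat.coprodIsoDirectSum A).hom ≫ ModuleCat.ofHom (X := Π₀ i, A i) (Y := Π₀ i, B i)
      (DFinsupp.mapRange.linearMap fun i ↦ (f i).hom) =
        Limits.Sigma.map f ≫ (ModuleCat.coprodIsoDirectSum B).hom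
    refine Sigma.hom_ext _ _ fun i ↦ ?_
    rw [Sigma.ι_map_assoc, ModuleCat.ι_coprodIsoDirectSum_hom]
    erw [← Category.assoc, ModuleCat.ι_coprodIsoDirectSum_hom]
    refine ModuleCat.hom_ext (LinearMap.ext fun x ↦ ?_)
    exact DFinsupp.mapRange_single (f := fun i ↦ (f i).hom) (hf := fun i ↦ map_zero _)

variable (R) in
/-- Inclusions of submodules with Lucas quotient of a large free module. -/
def lucasGenerators : MorphismProperty (ModuleCat.{u} R) :=
  ofHoms fun K : {K : Submodule R (LucasTerm R →₀ R) //
    HasLucasSolutions R ((LucasTerm R →₀ R) ⧸ K)} ↦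
    ModuleCat.ofHom (X := K.1) (Y := LucasTerm R →₀ R) K.1.subtype

lemma lucasGenerators_ofHom_subtype {K : Submodule R (LucasTerm R →₀ R)}
    (hK : HasLucasSolutions R ((LucasTerm R →₀ R) ⧸ K)) :
    lucasGenerators R (ModuleCat.ofHom (X := K) (Y := LucasTerm R →₀ R) K.subtype) :=
  ofHoms.mk (f := fun K : {K : Submodule R (LucasTerm R →₀ R) //
    HasLucasSolutions R ((LucasTerm R →₀ R) ⧸ K)} ↦
    ModuleCat.ofHom (X := K.1) (Y := LucasTerm R →₀ R) K.1.subtype) ⟨K, hK⟩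

lemma lucasGenerators_le_lucasMonomorphisms : lucasGenerators R ≤ lucasMonomorphisms R := by
  rintro _ _ _ ⟨K⟩
  constructor
  · rw [ModuleCat.mono_iff_injective]
    exact K.1.subtype_injective
  · rw [hasLucasSolutions_cokernel_iff, ModuleCat.hom_ofHom, Submodule.range_subtype]
    exact K.2

lemma pushouts_coproducts_lucasGenerators_le :
    (coproducts.{u} (lucasGenerators R)).pushouts ≤ lucasMonomorphisms R := by
  simpa only [pushouts_le_iff, coproducts_le_iff] using lucasGenerators_le_lucasMonomorphisms

instance : HasSmallObjectArgument.{u} (lucasGenerators R) := by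
  let G := ModuleCat.of R (LucasTerm R →₀ R)
  obtain ⟨κ, hκ', hκ⟩ := HasCardinalLT.exists_regular_cardinal.{u} (Subobject G)
  have : Fact κ.IsRegular := ⟨hκ'⟩
  have : Nonempty κ.ord.ToType := by simpa using hκ'.ne_zero
  have := WellFoundedLT.toOrderBot κ.ord.ToType
  have : IsSmall.{u} (lucasGenerators R) := by
    unfold lucasGenerators
    infer_instance
  exact ⟨κ, inferInstance, inferInstance,
    { preservesColimit {A B X Y} i hi f hf := by
        let hf' : (monomorphisms (ModuleCat.{u} R)).TransfiniteCompositionOfShape κ.ord.ToType f :=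
          { toTransfiniteCompositionOfShape := hf.toTransfiniteCompositionOfShape
            map_mem j hj := by
              have := (hf.attachCells j hj).pushouts_coproducts
              simp only [ofHoms_homFamily] at this
              exact (pushouts_coproducts_lucasGenerators_le _ this).1 }
        have (j j' : κ.ord.ToType) (φ : j ⟶ j') : Mono (hf'.F.map φ) := hf'.mem_map φ
        apply IsGrothendieckAbelian.preservesColimit_coyoneda_obj_of_mono (Y := hf'.F) (κ := κ)
        have := (lucasGenerators_le_lucasMonomorphisms _ hi).1
        obtain ⟨K⟩ := hi
        exact Subobject.hasCardinalLT_of_mono hκ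
          (ModuleCat.ofHom (X := K.1) (Y := LucasTerm R →₀ R) K.1.subtype) }⟩

lemma lucasMonomorphisms.hasLucasSolutions {A B : ModuleCat.{u} R} {f : A ⟶ B}
    (hf : lucasMonomorphisms R f) (hA : HasLucasSolutions R A) : HasLucasSolutions R B := by
  have := (ModuleCat.mono_iff_injective f).1 hf.1
  exact HasLucasSolutions.of_extension
    ((LinearEquiv.ofInjective f.hom this).hasLucasSolutions hA)
    ((hasLucasSolutions_cokernel_iff f).1 hf.2)

lemma hasLucasSolutions_of_transfiniteCompositionOfShape {J : Type u} [LinearOrder J] [SuccOrder J]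
    [OrderBot J] [WellFoundedLT J] {A B : ModuleCat.{u} R} {f : A ⟶ B}
    (hf : (lucasMonomorphisms R).TransfiniteCompositionOfShape J f)
    (hA : HasLucasSolutions R A) : HasLucasSolutions R B := by
  have h (j : J) : HasLucasSolutions R (hf.F.obj j) := by
    induction j using SuccOrder.limitRecOn with
    | isMin j hj =>
      obtain rfl := hj.eq_bot
      exact hf.isoBot.symm.hasLucasSolutions hA
    | succ j hj ih => exact (hf.map_mem j hj).hasLucasSolutions ih
    | isSuccLimit j hj ih =>
      have : Nonempty (Set.Iio j) := ⟨⟨⊥, hj.bot_lt⟩⟩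
      exact hasLucasSolutions_of_isColimit (hf.F.isColimitOfIsWellOrderContinuous j hj)
        fun i ↦ ih i.1 i.2
  exact hasLucasSolutions_of_isColimit hf.isColimit h

variable (R) in
/-- Every module receives a map from a Lucas module having the right lifting property with respect
to `lucasGenerators R`. -/
lemma exists_rlp_lucasGenerators (M : ModuleCat.{u} R) :
    ∃ (X : ModuleCat.{u} R) (p : X ⟶ M), HasLucasSolutions R X ∧ (lucasGenerators R).rlp p := by
  obtain ⟨κ, _, _, _⟩ := HasSmallObjectArgument.exists_cardinal.{u} (I := lucasGenerators R)
  let f : ModuleCat.of R PUnit.{u + 1} ⟶ M := 0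
  obtain ⟨h⟩ := SmallObject.transfiniteCompositionsOfShape_ιObj (lucasGenerators R) κ f
  exact ⟨_, SmallObject.πObj (lucasGenerators R) κ f,
    hasLucasSolutions_of_transfiniteCompositionOfShape
      (h.ofLE pushouts_coproducts_lucasGenerators_le) .of_subsingleton,
    SmallObject.rlp_πObj _ _ _⟩

end Generators

section Precover

variable {R : Type u} [CommRing R]

lemma lucasGenerators.exists_lift {X M : ModuleCat.{u} R} {p : X ⟶ M}
    (hp : (lucasGenerators R).rlp p) {K : Submodule R (LucasTerm R →₀ R)}
    (hK : HasLucasSolutions R ((LucasTerm R →₀ R) ⧸ K)) (α : K →ₗ[R] X)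
    (β : (LucasTerm R →₀ R) →ₗ[R] M) (h : p.hom ∘ₗ α = β ∘ₗ K.subtype) :
    ∃ ψ : (LucasTerm R →₀ R) →ₗ[R] X, ψ ∘ₗ K.subtype = α ∧ p.hom ∘ₗ ψ = β := by
  have := hp _ (lucasGenerators_ofHom_subtype hK)
  have sq : CommSq (ModuleCat.ofHom α) (ModuleCat.ofHom (X := K) (Y := LucasTerm R →₀ R) K.subtype)
      p (ModuleCat.ofHom β) := ⟨ModuleCat.hom_ext h⟩
  exact ⟨sq.lift.hom, congrArg ModuleCat.Hom.hom sq.fac_left,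
    congrArg ModuleCat.Hom.hom sq.fac_right⟩

variable {X M : ModuleCat.{u} R} {p : X ⟶ M} {C : Type u} [AddCommGroup C] [Module R C]

/-- The partial lifts of `g` through `p` whose domain has a Lucas quotient. -/
def lucasPartialLifts (p : X ⟶ M) (g : C →ₗ[R] M) : Set (C →ₗ.[R] X) :=
  {f | HasLucasSolutions R (C ⧸ f.domain) ∧ ∀ x : f.domain, p.hom (f x) = g x}

lemma exists_upperBound_lucasPartialLifts (hC : HasLucasSolutions R C) (g : C →ₗ[R] M)
    {c : Set (C →ₗ.[R] X)} (hc : c ⊆ lucasPartialLifts p g) (hc' : IsChain (· ≤ ·) c) :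
    ∃ f ∈ lucasPartialLifts p g, ∀ f' ∈ c, f' ≤ f := by
  obtain rfl | hne := c.eq_empty_or_nonempty
  · refine ⟨⊥, ⟨(Submodule.quotEquivOfEqBot _ rfl).symm.hasLucasSolutions hC, ?_⟩, by simp⟩
    rintro ⟨x, hx⟩
    obtain rfl : x = 0 := hx
    exact (congrArg p.hom (LinearPMap.map_zero _)).trans
      ((map_zero p.hom).trans (map_zero g).symm)
  · refine ⟨LinearPMap.sSup c hc'.directedOn, ⟨?_, fun x ↦ ?_⟩,
      fun f hf ↦ LinearPMap.le_sSup _ hf⟩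
    · rw [LinearPMap.domain_sSup]
      refine hasLucasSolutions_quotient_sSup (hne.image _)
        (hc'.directedOn.mono_comp LinearPMap.domain_mono.monotone) ?_
      rintro _ ⟨f, hf, rfl⟩
      exact (hc hf).1
    · obtain ⟨f, hf, hx⟩ := (LinearPMap.mem_domain_sSup_iff hne hc'.directedOn).1 x.2
      rw [← (LinearPMap.le_sSup hc'.directedOn hf).2 (x := ⟨x, hx⟩) rfl]
      exact (hc hf).2 _

lemma exists_mem_domain_lucasPartialLifts (hp : (lucasGenerators R).rlp p) (g : C →ₗ[R] M)
    {f : C →ₗ.[R] X} (hf : f ∈ lucasPartialLifts p g) (y : C) :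
    ∃ f' ∈ lucasPartialLifts p g, f ≤ f' ∧ y ∈ f'.domain := by
  obtain ⟨π, ⟨z, hz⟩, hπ, hK⟩ := hf.1.exists_linearMap (f.domain.mkQ y)
  obtain ⟨ρ, hρ⟩ := Module.projective_lifting_property f.domain.mkQ π f.domain.mkQ_surjective
  have hρ' (k) : k ∈ LinearMap.ker π ↔ ρ k ∈ f.domain := by
    rw [← hρ, LinearMap.mem_ker, LinearMap.comp_apply, Submodule.mkQ_apply,
      Submodule.Quotient.mk_eq_zero]
  let α : LinearMap.ker π →ₗ[R] X :=
    f.toFun ∘ₗ (ρ ∘ₗ (LinearMap.ker π).subtype).codRestrict f.domain fun k ↦ (hρ' _).1 k.2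
  obtain ⟨ψ, hψ, hψ'⟩ := lucasGenerators.exists_lift hp hK α (g ∘ₗ ρ)
    (LinearMap.ext fun k ↦ hf.2 _)
  have hψf (k) (d : f.domain) (hkd : ρ k = d) : ψ k = f d := by
    have hk : k ∈ LinearMap.ker π := (hρ' k).2 (hkd ▸ d.2)
    refine (LinearMap.congr_fun hψ ⟨k, hk⟩).trans ?_
    exact congrArg f.toFun (Subtype.ext hkd)
  have hker : LinearMap.ker ρ ≤ LinearMap.ker ψ := fun k hk ↦ by
    rw [LinearMap.mem_ker, hψf k 0 (by simpa using hk), LinearPMap.map_zero]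
  let f₁ : C →ₗ.[R] X := ⟨LinearMap.range ρ,
    (LinearMap.ker ρ).liftQ ψ hker ∘ₗ ρ.quotKerEquivRange.symm.toLinearMap⟩
  have hf₁ (k) : f₁ ⟨ρ k, k, rfl⟩ = ψ k := by
    have : ρ.quotKerEquivRange.symm ⟨ρ k, k, rfl⟩ = Submodule.Quotient.mk k := by
      rw [LinearEquiv.symm_apply_eq]; rfl
    change (LinearMap.ker ρ).liftQ ψ hker (ρ.quotKerEquivRange.symm ⟨ρ k, k, rfl⟩) = _
    rw [this, Submodule.liftQ_apply]
  have hcompat (d : f.domain) (x : f₁.domain) (hdx : (d : C) = x) : f d = f₁ x := by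
    obtain ⟨_, k, rfl⟩ := x
    rw [hf₁, hψf k d hdx.symm]
  refine ⟨f.sup f₁ hcompat, ⟨?_, fun x ↦ ?_⟩, LinearPMap.left_le_sup _ _ _, ?_⟩
  · refine HasLucasSolutions.quotient_of_le (S := f.domain) le_sup_left ?_
    have : (f.sup f₁ hcompat).domain.map f.domain.mkQ = LinearMap.range π := by
      rw [LinearPMap.domain_sup, Submodule.map_sup, Submodule.mkQ_map_self, bot_sup_eq, ← hρ,
        LinearMap.range_comp]
    rwa [this]
  · obtain ⟨d, hd, _, ⟨k, rfl⟩, hx⟩ := Submodule.mem_sup.1 x.2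
    rw [LinearPMap.sup_apply hcompat ⟨d, hd⟩ ⟨ρ k, k, rfl⟩ x hx, hf₁, map_add, hf.2, ← hx, map_add]
    exact congrArg _ (LinearMap.congr_fun hψ' k)
  · refine Submodule.mem_sup.2 ⟨y - ρ z, ?_, ρ z, ⟨z, rfl⟩, sub_add_cancel _ _⟩
    rw [← Submodule.Quotient.eq]
    exact hz.symm.trans (LinearMap.congr_fun hρ z).symm

lemma HasLucasSolutions.exists_lift_of_rlp (hC : HasLucasSolutions R C)
    (hp : (lucasGenerators R).rlp p) (g : C →ₗ[R] M) : ∃ h : C →ₗ[R] X, p.hom ∘ₗ h = g := by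
  obtain ⟨f, hf⟩ := zorn_le₀ (lucasPartialLifts p g)
    fun c hc hc' ↦ exists_upperBound_lucasPartialLifts hC g hc hc'
  have htop (y) : y ∈ f.domain := by
    obtain ⟨f', hf', hle, hy⟩ := exists_mem_domain_lucasPartialLifts hp g hf.prop y
    exact (hf.le_of_ge hf' hle).1 hy
  exact ⟨f.toFun ∘ₗ LinearMap.id.codRestrict f.domain htop, LinearMap.ext fun y ↦ hf.prop.2 _⟩

end Precover

section Iteration

open Limits

/-- There is a well-order without maximum which has no strictly monotone map to `α`. -/
lemma exists_wellOrder_forall_not_strictMono (α : Type u) [PartialOrder α] :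
    ∃ (J : Type u) (_ : LinearOrder J) (_ : SuccOrder J) (_ : OrderBot J) (_ : WellFoundedLT J)
      (_ : NoMaxOrder J), ∀ f : J → α, ¬ StrictMono f := by
  let κ : Cardinal.{u} := max Cardinal.aleph0 (Order.succ (Cardinal.mk α))
  have hκ : Cardinal.aleph0 ≤ κ := le_max_left _ _
  have : NoMaxOrder κ.ord.ToType := Cardinal.noMaxOrder hκ
  have : Nonempty κ.ord.ToType := by
    simpa using (Cardinal.aleph0_pos.trans_le hκ).ne'
  refine ⟨κ.ord.ToType, inferInstance, SuccOrder.ofLinearWellFoundedLT _,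
    WellFoundedLT.toOrderBot _, inferInstance, inferInstance, fun f hf ↦ ?_⟩
  refine (Cardinal.mk_le_of_injective hf.injective).not_gt ?_
  rw [Cardinal.mk_ord_toType]
  exact (Order.lt_succ _).trans_le (le_max_right _ _)

lemma Monotone.strictMono_of_lt_succ {J α : Type*} [LinearOrder J] [SuccOrder J] [NoMaxOrder J]
    [Preorder α] {f : J → α} (hf : Monotone f) (h : ∀ j, f j < f (Order.succ j)) : StrictMono f :=
  fun _ _ hij ↦ (h _).trans_le (hf (Order.succ_le_of_lt hij))

universe v w

variable {D : Type w} [Category.{v} D] [HasColimitsOfSize.{u, u} D] {P : ObjectProperty D}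

/-- An object property is closed under colimits of nonempty chains. -/
def CategoryTheory.ObjectProperty.IsClosedUnderChains (P : ObjectProperty D) : Prop :=
  ∀ ⦃K : Type u⦄ [LinearOrder K] [Nonempty K] ⦃F : K ⥤ D⦄ (c : Cocone F), IsColimit c →
    (∀ k, P (F.obj k)) → P c.pt

lemma CategoryTheory.SmallObject.SuccStruct.prop_iterationFunctor_obj
    (hP : P.IsClosedUnderChains.{u}) (Φ : SmallObject.SuccStruct D) (h₀ : P Φ.X₀)
    (hsucc : ∀ X, P X → P (Φ.succ X)) {J : Type u} [LinearOrder J] [SuccOrder J] [OrderBot J]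
    [WellFoundedLT J] (j : J) : P ((Φ.iterationFunctor J).obj j) := by
  induction j using SuccOrder.limitRecOn with
  | isMin j hj =>
    obtain rfl := hj.eq_bot
    rwa [show (Φ.iterationFunctor J).obj ⊥ = Φ.X₀ from (Φ.iter ⊥).obj_bot]
  | succ j hj ih =>
    rw [← (Φ.prop_iterationFunctor_map_succ j hj).succ_eq]
    exact hsucc _ ih
  | isSuccLimit j hj ih =>
    have : Nonempty (Set.Iio j) := ⟨⟨⊥, hj.bot_lt⟩⟩
    exact hP (K := Set.Iio j) _ ((Φ.iterationFunctor J).isColimitOfIsWellOrderContinuous j hj)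
      fun i ↦ ih i.1 i.2

/-- Extending an object by maps satisfying `Q` inside a class closed under colimits of chains stops
provided that there are no long chains of such maps. -/
lemma CategoryTheory.ObjectProperty.IsClosedUnderChains.exists_forall_not
    (hP : P.IsClosedUnderChains.{u}) (Q : MorphismProperty D) {X : D} (hX : P X)
    (J : Type u) [LinearOrder J] [SuccOrder J] [OrderBot J] [WellFoundedLT J] [NoMaxOrder J]
    (hQ : ∀ F : J ⥤ D, (∀ j, P (F.obj j)) → ∃ j, ¬ Q (F.map (homOfLE (Order.le_succ j)))) :
    ∃ Y, P Y ∧ Nonempty (X ⟶ Y) ∧ ∀ Z (g : Y ⟶ Z), P Z → ¬ Q g := by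
  by_contra! h
  let P' : ObjectProperty D := fun Y ↦ P Y ∧ Nonempty (X ⟶ Y)
  have hP' : P'.IsClosedUnderChains.{u} := fun K _ _ F c hc hF ↦
    ⟨hP c hc fun k ↦ (hF k).1, (hF (Classical.arbitrary K)).2.map (· ≫ c.ι.app _)⟩
  have h' (Y : D) : ∃ (Z : D) (g : Y ⟶ Z), P' Y → P Z ∧ Q g := by
    by_cases hY : P' Y
    · obtain ⟨Z, g, hZ⟩ := h Y hY.1 hY.2
      exact ⟨Z, g, fun _ ↦ hZ⟩
    · exact ⟨Y, 𝟙 Y, fun hY' ↦ (hY hY').elim⟩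
  choose succ toSucc hΦ using h'
  let Φ : SmallObject.SuccStruct D := ⟨X, succ, toSucc⟩
  have hF (j : J) : P' ((Φ.iterationFunctor J).obj j) :=
    Φ.prop_iterationFunctor_obj hP' ⟨hX, ⟨𝟙 X⟩⟩
      (fun Y hY ↦ ⟨(hΦ Y hY).1, hY.2.map (· ≫ toSucc Y)⟩) j
  have hΦQ {A B : D} {f : A ⟶ B} (hf : Φ.prop f) (hA : P' A) : Q f := by
    obtain ⟨A⟩ := hf
    exact (hΦ A hA).2
  obtain ⟨j, hj⟩ := hQ _ fun j ↦ (hF j).1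
  exact hj (hΦQ (Φ.prop_iterationFunctor_map_succ j (not_isMax j)) (hF j))

end Iteration

section Cover

open Limits

variable {R : Type u} [CommRing R] {M : ModuleCat.{u} R}

/-- The property that the domain of a map to `M` is a Lucas module. -/
def lucasOver (M : ModuleCat.{u} R) : ObjectProperty (Over M) :=
  fun X ↦ HasLucasSolutions R X.left

lemma lucasOver_isClosedUnderChains : (lucasOver M).IsClosedUnderChains.{u} := fun _ _ _ F _ hc h ↦
  hasLucasSolutions_of_isColimit (F := F ⋙ Over.forget M)
    (isColimitOfPreserves (Over.forget M) hc) h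

lemma inverseImage_lucasOver_isClosedUnderChains (W : Over M) :
    ((lucasOver M).inverseImage (Under.forget W)).IsClosedUnderChains.{u} := fun K _ _ F _ hc h ↦
  have := IsFiltered.isConnected K
  lucasOver_isClosedUnderChains (F := F ⋙ Under.forget W) _
    (isColimitOfPreserves (Under.forget W) hc) h

lemma CategoryTheory.Over.exists_rep_of_isColimit {K : Type u} [LinearOrder K] [Nonempty K]
    {F : K ⥤ Over M} {c : Cocone F} (hc : IsColimit c) (x : c.pt.left) :
    ∃ (k : K) (y : (F.obj k).left), (c.ι.app k).left.hom y = x :=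
  Concrete.isColimit_exists_rep (F ⋙ Over.forget M) (isColimitOfPreserves (Over.forget M) hc) x

/-- The kernel of a map of modules over `M`. -/
abbrev CategoryTheory.Over.kernel {X Y : Over M} (f : X ⟶ Y) : Submodule R X.left :=
  LinearMap.ker f.left.hom

lemma CategoryTheory.Over.kernel_le_kernel_comp {X Y Z : Over M} (f : X ⟶ Y) (g : Y ⟶ Z) :
    Over.kernel f ≤ Over.kernel (f ≫ g) := by
  intro x hx
  rw [LinearMap.mem_ker] at hx ⊢
  rw [Over.comp_left, ModuleCat.hom_comp, LinearMap.comp_apply, hx, map_zero]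

lemma exists_forall_kernel_comp_le {W : Over M} (hW : lucasOver M W) :
    ∃ (Y : Over M) (f : W ⟶ Y), lucasOver M Y ∧
      ∀ (Z : Over M) (g : Y ⟶ Z), lucasOver M Z → Over.kernel (f ≫ g) ≤ Over.kernel f := by
  obtain ⟨J, _, _, _, _, _, hJ⟩ := exists_wellOrder_forall_not_strictMono (Submodule R W.left)
  obtain ⟨Y, hY, -, h⟩ := (inverseImage_lucasOver_isClosedUnderChains W).exists_forall_not
    (X := Under.mk (𝟙 W)) (fun A B _ ↦ Over.kernel A.hom < Over.kernel B.hom) hW J fun F _ ↦ by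
      by_contra! hF
      refine hJ (fun j ↦ Over.kernel (F.obj j).hom) (Monotone.strictMono_of_lt_succ ?_ hF)
      intro i j hij
      dsimp only
      rw [← Under.w (F.map (homOfLE hij))]
      exact Over.kernel_le_kernel_comp _ _
  refine ⟨Y.right, Y.hom, hY, fun Z g hZ ↦ ?_⟩
  by_contra hlt
  exact h (Under.mk (Y.hom ≫ g)) (Under.homMk g) hZ
    (lt_of_le_not_ge (Over.kernel_le_kernel_comp _ _) hlt)

/-- Maps over `M` from `X` to any Lucas module are injective. -/
def lucasOverMono (M : ModuleCat.{u} R) : ObjectProperty (Over M) :=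
  fun X ↦ lucasOver M X ∧ ∀ (Y : Over M) (f : X ⟶ Y), lucasOver M Y →
    Function.Injective f.left.hom

lemma exists_hom_lucasOverMono {W : Over M} (hW : lucasOver M W) :
    ∃ V : Over M, lucasOverMono M V ∧ Nonempty (W ⟶ V) := by
  have h (X : Over M) : ∃ (Y : Over M) (f : X ⟶ Y), lucasOver M X → lucasOver M Y ∧
      ∀ (Z : Over M) (g : Y ⟶ Z), lucasOver M Z → Over.kernel (f ≫ g) ≤ Over.kernel f := by
    by_cases hX : lucasOver M X
    · obtain ⟨Y, f, hY⟩ := exists_forall_kernel_comp_le hX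
      exact ⟨Y, f, fun _ ↦ hY⟩
    · exact ⟨X, 𝟙 X, fun hX' ↦ (hX hX').elim⟩
  choose succ toSucc hΦ using h
  obtain ⟨J, _, _, _, _, _, -⟩ := exists_wellOrder_forall_not_strictMono PUnit.{u + 1}
  let Φ : SmallObject.SuccStruct (Over M) := ⟨W, succ, toSucc⟩
  have hF (j : J) := Φ.prop_iterationFunctor_obj lucasOver_isClosedUnderChains hW
    (fun Y hY ↦ (hΦ Y hY).1) j
  have hprop {A B : Over M} {f : A ⟶ B} (hf : Φ.prop f) (hA : lucasOver M A) (Z : Over M)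
      (g : B ⟶ Z) (hZ : lucasOver M Z) : Over.kernel (f ≫ g) ≤ Over.kernel f := by
    obtain ⟨A⟩ := hf
    exact (hΦ A hA).2 Z g hZ
  let c := Φ.iterationCocone J
  have hc : IsColimit c := Φ.isColimitIterationCocone J
  refine ⟨c.pt, ⟨lucasOver_isClosedUnderChains c hc hF, fun Z g hZ ↦ ?_⟩, ⟨Φ.ιIteration J⟩⟩
  rw [← LinearMap.ker_eq_bot, LinearMap.ker_eq_bot']
  intro x hx
  obtain ⟨j, x, rfl⟩ := Over.exists_rep_of_isColimit hc x
  have e := c.w (homOfLE (Order.le_succ j))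
  have hx' : x ∈ Over.kernel (c.ι.app j ≫ g) := hx
  rw [← e, Category.assoc] at hx'
  have hx₀ := Over.kernel_le_kernel_comp _ (c.ι.app (Order.succ j))
    (hprop (Φ.prop_iterationFunctor_map_succ j (not_isMax j)) (hF j) Z _ hZ hx')
  rwa [e] at hx₀

lemma lucasOverMono_isClosedUnderChains : (lucasOverMono M).IsClosedUnderChains.{u} := by
  intro K _ _ F c hc h
  refine ⟨lucasOver_isClosedUnderChains c hc fun k ↦ (h k).1, fun Z g hZ ↦ ?_⟩
  rw [← LinearMap.ker_eq_bot, LinearMap.ker_eq_bot']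
  intro x hx
  obtain ⟨k, x, rfl⟩ := Over.exists_rep_of_isColimit hc x
  have hx0 : x = 0 := (h k).2 Z (c.ι.app k ≫ g) hZ (hx.trans (map_zero _).symm)
  rw [hx0]
  exact map_zero (c.ι.app k).left.hom

/-- A Lucas module over `M` is weakly terminal if all Lucas modules over `M` map to it. -/
def IsWeaklyTerminalLucasOver (X : Over M) : Prop :=
  lucasOver M X ∧ ∀ Y, lucasOver M Y → Nonempty (Y ⟶ X)

lemma exists_isWeaklyTerminalLucasOver_forall_bijective {W : Over M}
    (hW : IsWeaklyTerminalLucasOver W) :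
    ∃ U : Over M, IsWeaklyTerminalLucasOver U ∧ ∀ h : U ⟶ U, Function.Bijective h.left.hom := by
  obtain ⟨V, hV, ⟨a⟩⟩ := exists_hom_lucasOverMono hW.1
  obtain ⟨J, _, _, _, _, _, hJ⟩ := exists_wellOrder_forall_not_strictMono (Submodule R V.left)
  obtain ⟨U, hU, ⟨b⟩, h⟩ := lucasOverMono_isClosedUnderChains.exists_forall_not
    (fun _ _ f ↦ ¬ Function.Surjective f.left.hom) hV J fun F hF ↦ by
      by_contra! hsurj
      let c := colimit.cocone F
      have hc := lucasOverMono_isClosedUnderChains c (colimit.isColimit F) hF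
      obtain ⟨d⟩ := hW.2 _ hc.1
      have e {i j : J} (hij : i ≤ j) : (c.ι.app i ≫ d ≫ a).left.hom =
          (c.ι.app j ≫ d ≫ a).left.hom ∘ₗ (F.map (homOfLE hij)).left.hom := by
        rw [← ModuleCat.hom_comp, ← Over.comp_left, c.w_assoc]
      have hmono : Monotone fun j ↦ LinearMap.range (c.ι.app j ≫ d ≫ a).left.hom := by
        intro i j hij
        dsimp only
        rw [e hij]
        exact LinearMap.range_comp_le_range _ _
      refine hJ _ (hmono.strictMono_of_lt_succ fun j ↦ lt_of_le_not_ge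
        (hmono (Order.le_succ j)) fun hle ↦ hsurj j fun y ↦ ?_)
      obtain ⟨x, hx⟩ := hle ⟨y, rfl⟩
      rw [e (Order.le_succ j)] at hx
      exact ⟨x, (hF (Order.succ j)).2 _ (c.ι.app (Order.succ j) ≫ d ≫ a) hV.1 hx⟩
  refine ⟨U, ⟨hU.1, fun Y hY ↦ (hW.2 Y hY).map (· ≫ a ≫ b)⟩, fun g ↦ ?_⟩
  exact ⟨hU.2 _ g hU.1, not_not.1 (h U g hU)⟩

end Cover

lemma exists_isWeaklyTerminalLucasOver {R : Type u} [CommRing R] (M : ModuleCat.{u} R) :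
    ∃ W : Over M, IsWeaklyTerminalLucasOver W := by
  obtain ⟨X, p, hX, hp⟩ := exists_rlp_lucasGenerators R M
  refine ⟨Over.mk p, hX, fun Y hY ↦ ?_⟩
  obtain ⟨h, hh⟩ := HasLucasSolutions.exists_lift_of_rlp hY hp Y.hom.hom
  exact ⟨Over.homMk (ModuleCat.ofHom h) (ModuleCat.hom_ext hh)⟩

/-- Every `R`-module has a cover with respect to the class `ℒ` of Lucas
modules: there is `f : C → M` with `C` Lucas such that `Hom(C', C) → Hom(C', M)` is
surjective for every Lucas module `C'`, and every endomorphism `h` of `C` with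
`f ∘ h = f` is an isomorphism. -/
theorem exists_lucas_cover (R : Type u) [CommRing R]
    (M : Type u) [AddCommGroup M] [Module R M] :
    ∃ (C : ModuleCat.{u} R) (f : C →ₗ[R] M),
      IsLucasModule R C ∧
      (∀ C' : ModuleCat.{u} R, IsLucasModule R C' →
        Function.Surjective (fun g : C' →ₗ[R] C => f.comp g)) ∧
      (∀ h : C →ₗ[R] C, f.comp h = f → Function.Bijective h) := by
  obtain ⟨W, hW⟩ := exists_isWeaklyTerminalLucasOver (ModuleCat.of R M)
  obtain ⟨U, hU, h⟩ := exists_isWeaklyTerminalLucasOver_forall_bijective hW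
  refine ⟨U.left, U.hom.hom, isLucasModule_iff_hasLucasSolutions.2 hU.1, fun C' hC' g ↦ ?_,
    fun e he ↦ h (Over.homMk (ModuleCat.ofHom e) (ModuleCat.hom_ext he))⟩
  obtain ⟨a⟩ := hU.2 (Over.mk (ModuleCat.ofHom (Y := M) g))
    (isLucasModule_iff_hasLucasSolutions.1 hC')
  exact ⟨a.left.hom, congrArg ModuleCat.Hom.hom (Over.w a)⟩
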